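/- Let L be a nilpotent symplectic alternating algebra of dimension 2n ≥ 12 over any field with dim Z(L) = 2 and nilpotency class k. Then L^k = Z(L) and 5 ≤ k ≤ 2n − 3. -/

import Mathlib

/-- A symplectic alternating algebra structure on an `F`-vector space `L`:
a nondegenerate alternating bilinear form together with an alternating
bilinear product satisfying `(x·y, z) = (y·z, x)`. -/
structure SAAStruct (F : Type*) [Field F] (L : Type*) [AddCommGroup L] [Module F L] where
  form : L →ₗ[F] L →ₗ[F] F
  mul : L →ₗ[F] L →ₗ[F] L
  form_alt : ∀ x : L, form x x = 0
  form_nondegen : ∀ x : L, (∀ y : L, form x y = 0) → x = 0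
  mul_alt : ∀ x : L, mul x x = 0
  cyclic : ∀ x y z : L, form (mul x y) z = form (mul y z) x

namespace SAAStruct

variable {F : Type*} [Field F] {L : Type*} [AddCommGroup L] [Module F L]

/-- `I` is an ideal of the symplectic alternating algebra `A`. -/
def IsIdealSub (A : SAAStruct F L) (I : Submodule F L) : Prop :=
  ∀ x ∈ I, ∀ y : L, A.mul x y ∈ I

/-- An ascending chain of ideals `⊥ = I 0 ≤ I 1 ≤ ⋯ ≤ I k = ⊤`
with `I (s+1) · L ⊆ I s`. -/
def CentralChain (A : SAAStruct F L) (I : ℕ → Submodule F L) (k : ℕ) : Prop :=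
  I 0 = ⊥ ∧ I k = ⊤ ∧ (∀ s, s < k → I s ≤ I (s + 1)) ∧
  (∀ s, s ≤ k → A.IsIdealSub (I s)) ∧
  (∀ s, s < k → ∀ x ∈ I (s + 1), ∀ y : L, A.mul x y ∈ I s)

/-- `A` is nilpotent if it admits a central chain of ideals. -/
def IsNilpotent (A : SAAStruct F L) : Prop :=
  ∃ (k : ℕ) (I : ℕ → Submodule F L), A.CentralChain I k

/-- The nilpotency class of `A`: the least length of a central chain of ideals. -/
noncomputable def nilClass (A : SAAStruct F L) : ℕ :=
  sInf {k | ∃ I : ℕ → Submodule F L, A.CentralChain I k}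

/-- The center `Z(L) = {x : x·L = 0}`. -/
def center (A : SAAStruct F L) : Submodule F L := LinearMap.ker A.mul

/-- The lower central series, indexed so that `lcs A i` is `L^(i+1)`:
`lcs A 0 = L¹ = L` and `lcs A (i+1) = L^(i+2) = span {u·v : u ∈ L^(i+1), v ∈ L}`. -/
def lcs (A : SAAStruct F L) : ℕ → Submodule F L
  | 0 => ⊤
  | (i + 1) => Submodule.span F {z | ∃ u ∈ A.lcs i, ∃ v : L, z = A.mul u v}

/-- The upper central series: `ucs A 0 = 0`, `ucs A (i+1) = {x : x·L ⊆ ucs A i}`. -/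
def ucs (A : SAAStruct F L) : ℕ → Submodule F L
  | 0 => ⊥
  | (i + 1) =>
    { carrier := {x | ∀ y : L, A.mul x y ∈ A.ucs i}
      add_mem' := by
        intro a b ha hb y
        simpa [map_add, LinearMap.add_apply] using
          Submodule.add_mem _ (ha y) (hb y)
      zero_mem' := by
        intro y
        simp
      smul_mem' := by
        intro c a ha y
        simpa [map_smul, LinearMap.smul_apply] using
          Submodule.smul_mem _ c (ha y) }

/-- The perp `U^⊥ = {x : (x,u) = 0 for all u ∈ U}` of a subspace with
respect to the alternating form of `A`. -/
def perp (A : SAAStruct F L) (U : Submodule F L) : Submodule F L :=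
  { carrier := {x | ∀ u ∈ U, A.form x u = 0}
    add_mem' := by
      intro a b ha hb u hu
      simp [map_add, LinearMap.add_apply, ha u hu, hb u hu]
    zero_mem' := by
      intro u hu
      simp
    smul_mem' := by
      intro c a ha u hu
      simp [map_smul, LinearMap.smul_apply, ha u hu] }

/-- A subspace is isotropic if the form vanishes identically on it. -/
def Isotropic (A : SAAStruct F L) (U : Submodule F L) : Prop :=
  ∀ u ∈ U, ∀ v ∈ U, A.form u v = 0

/-- A subspace is abelian if the product vanishes identically on it. -/
def AbelianSub (A : SAAStruct F L) (U : Submodule F L) : Prop :=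
  ∀ u ∈ U, ∀ v ∈ U, A.mul u v = 0

end SAAStruct

/-- The function `Ω` with `Ω 0 = 0` and `Ω (m+1) = 2 + C(Ω m, 2)`. -/
def OmegaFn : ℕ → ℕ
  | 0 => 0
  | (m + 1) => 2 + Nat.choose (OmegaFn m) 2

/-- The entries of the Gram matrix of a standard (symplectic) basis
`x₁, y₁, x₂, y₂, …` enumerated as `b 0 = x₁, b 1 = y₁, b 2 = x₂, …`. -/
def stdJ (F : Type*) [Field F] {N : ℕ} (i j : Fin N) : F :=
  if (i : ℕ) % 2 = 0 ∧ (j : ℕ) = (i : ℕ) + 1 then 1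
  else if (j : ℕ) % 2 = 0 ∧ (i : ℕ) = (j : ℕ) + 1 then -1
  else 0

namespace SAAStruct

open Module

section LinearAlgebra

variable {F : Type*} [Field F] {L : Type*} [AddCommGroup L] [Module F L] [FiniteDimensional F L]

theorem exists_le_span_singleton_sup {U V : Submodule F L}
    (hf : finrank F V ≤ finrank F U + 1) (h : U ≤ V) :
    ∃ c ∈ V, V ≤ F ∙ c ⊔ U := by
  by_cases hVU : V ≤ U
  · exact ⟨0, V.zero_mem, hVU.trans le_sup_right⟩
  · obtain ⟨c, hcV, hcU⟩ := SetLike.not_le_iff_exists.mp hVU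
    refine ⟨c, hcV, ?_⟩
    have hle : F ∙ c ⊔ U ≤ V :=
      sup_le ((Submodule.span_singleton_le_iff_mem c V).2 hcV) h
    have hlt : U < F ∙ c ⊔ U := lt_of_le_of_ne le_sup_right fun he =>
      hcU (he ▸ (le_sup_left : F ∙ c ≤ F ∙ c ⊔ U) (Submodule.mem_span_singleton_self c))
    have := Submodule.finrank_lt_finrank_of_lt hlt
    exact (Submodule.eq_of_le_of_finrank_le hle (by omega)).ge

theorem exists_le_span_pair_sup {U V : Submodule F L}
    (hf : finrank F V ≤ finrank F U + 2) (h : U ≤ V) :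
    ∃ x y : L, V ≤ Submodule.span F {x, y} ⊔ U := by
  by_cases hVU : V ≤ U
  · exact ⟨0, 0, hVU.trans le_sup_right⟩
  · obtain ⟨c, hcV, hcU⟩ := SetLike.not_le_iff_exists.mp hVU
    have hle : F ∙ c ⊔ U ≤ V :=
      sup_le ((Submodule.span_singleton_le_iff_mem c V).2 hcV) h
    have hlt : U < F ∙ c ⊔ U := lt_of_le_of_ne le_sup_right fun he =>
      hcU (he ▸ (le_sup_left : F ∙ c ≤ F ∙ c ⊔ U) (Submodule.mem_span_singleton_self c))
    have := Submodule.finrank_lt_finrank_of_lt hlt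
    obtain ⟨d, -, hd⟩ := exists_le_span_singleton_sup (by omega) hle
    refine ⟨d, c, hd.trans ?_⟩
    rw [Submodule.span_insert, sup_assoc]

theorem finrank_span_singleton_sup_le (c : L) (U : Submodule F L) :
    finrank F (F ∙ c ⊔ U : Submodule F L) ≤ finrank F U + 1 := by
  have h₁ := Submodule.finrank_add_le_finrank_add_finrank (F ∙ c) U
  have h₂ : finrank F (F ∙ c) ≤ 1 := by simpa using finrank_span_le_card (R := F) ({c} : Set L)
  omega

theorem finrank_span_pair_sup_le (c d : L) (U : Submodule F L) :
    finrank F (Submodule.span F {c, d} ⊔ U : Submodule F L) ≤ finrank F U + 2 := by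
  rw [Submodule.span_insert, sup_assoc]
  have h₁ := finrank_span_singleton_sup_le c (F ∙ d ⊔ U)
  have h₂ := finrank_span_singleton_sup_le d U
  omega

end LinearAlgebra

variable {F : Type*} [Field F] {L : Type*} [AddCommGroup L] [Module F L] (A : SAAStruct F L)

theorem form_swap (x y : L) : A.form x y = -A.form y x := by
  have h := A.form_alt (x + y)
  simp only [map_add, LinearMap.add_apply, A.form_alt, zero_add, add_zero] at h
  exact eq_neg_of_add_eq_zero_right h

theorem mul_swap (x y : L) : A.mul x y = -A.mul y x := by
  have h := A.mul_alt (x + y)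
  simp only [map_add, LinearMap.add_apply, A.mul_alt, zero_add, add_zero] at h
  exact eq_neg_of_add_eq_zero_right h

theorem mem_perp {U : Submodule F L} {x : L} : x ∈ A.perp U ↔ ∀ u ∈ U, A.form x u = 0 := Iff.rfl

theorem mem_ucs_succ {i : ℕ} {x : L} : x ∈ A.ucs (i + 1) ↔ ∀ y, A.mul x y ∈ A.ucs i := Iff.rfl

theorem mul_mem_lcs_succ {i : ℕ} {u : L} (hu : u ∈ A.lcs i) (v : L) :
    A.mul u v ∈ A.lcs (i + 1) :=
  Submodule.subset_span ⟨u, hu, v, rfl⟩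

theorem lcs_succ_le {i : ℕ} {W : Submodule F L} (h : ∀ u ∈ A.lcs i, ∀ v, A.mul u v ∈ W) :
    A.lcs (i + 1) ≤ W := by
  refine Submodule.span_le.2 ?_
  rintro _ ⟨u, hu, v, rfl⟩
  exact h u hu v

theorem lcs_antitone : Antitone A.lcs := by
  refine antitone_nat_of_succ_le fun i => ?_
  induction i with
  | zero => exact le_top
  | succ i ih => exact A.lcs_succ_le fun u hu v => A.mul_mem_lcs_succ (ih hu) v

theorem ucs_monotone : Monotone A.ucs := by
  refine monotone_nat_of_le_succ fun i => ?_
  induction i with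
  | zero => exact bot_le
  | succ i ih => exact fun x hx y => ih (hx y)

theorem ucs_one : A.ucs 1 = A.center := by
  ext x
  change (∀ y, A.mul x y ∈ (⊥ : Submodule F L)) ↔ A.mul x = 0
  simp [LinearMap.ext_iff]

theorem perp_lcs (i : ℕ) : A.perp (A.lcs i) = A.ucs i := by
  induction i with
  | zero =>
    ext x
    refine ⟨fun hx => ?_, fun hx => ?_⟩
    · exact A.form_nondegen x fun y => hx y trivial
    · intro u _
      rw [show x = 0 from hx, map_zero, LinearMap.zero_apply]
  | succ i ih =>
    ext x
    rw [mem_ucs_succ, ← ih]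
    have key (y u : L) : A.form (A.mul x y) u = A.form x (A.mul u y) := by
      rw [A.cyclic x y u, A.mul_swap y u, map_neg, LinearMap.neg_apply, ← A.form_swap]
    refine ⟨fun hx y u hu => (key y u).trans (hx _ (A.mul_mem_lcs_succ hu y)), fun hx => ?_⟩
    have hle : A.lcs (i + 1) ≤ LinearMap.ker (A.form x) :=
      A.lcs_succ_le fun u hu v => (key v u).symm.trans (hx v u hu)
    exact fun u hu => hle hu

theorem form_eq_zero_of_mem {i : ℕ} {x u : L} (hx : x ∈ A.ucs i) (hu : u ∈ A.lcs i) :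
    A.form x u = 0 := by
  rw [← perp_lcs] at hx
  exact hx u hu

theorem finrank_ucs_add_finrank_lcs [FiniteDimensional F L] (i : ℕ) :
    finrank F (A.ucs i) + finrank F (A.lcs i) = finrank F L := by
  have hnd : LinearMap.BilinForm.Nondegenerate A.form := by
    refine ⟨A.form_nondegen, fun x hx => A.form_nondegen x fun y => ?_⟩
    rw [A.form_swap, hx y, neg_zero]
  have h := LinearMap.BilinForm.finrank_orthogonal hnd (A.lcs i)
  have he : LinearMap.BilinForm.orthogonal A.form (A.lcs i) = A.ucs i := by
    rw [← perp_lcs]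
    ext x
    rw [LinearMap.BilinForm.mem_orthogonal_iff, mem_perp]
    refine forall₂_congr fun u _ => ?_
    change A.form u x = 0 ↔ _
    rw [A.form_swap, neg_eq_zero]
  rw [he] at h
  have := Submodule.finrank_le (A.lcs i)
  omega

theorem lcs_eq_bot_iff [FiniteDimensional F L] {i : ℕ} : A.lcs i = ⊥ ↔ A.ucs i = ⊤ := by
  have h := A.finrank_ucs_add_finrank_lcs i
  rw [← Submodule.finrank_eq_zero (R := F)]
  refine ⟨fun h0 => Submodule.eq_top_of_finrank_eq (by omega), fun ht => ?_⟩
  rw [ht, finrank_top] at h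
  omega

theorem lcs_le_ucs {i j : ℕ} (h : A.lcs (i + j) = ⊥) : A.lcs i ≤ A.ucs j := by
  induction j generalizing i with
  | zero => exact h.le
  | succ j ih =>
    exact fun x hx y => ih (i := i + 1) (by rw [← h]; congr 1; omega) (A.mul_mem_lcs_succ hx y)

theorem centralChain_ucs {k : ℕ} (h : A.ucs k = ⊤) : A.CentralChain A.ucs k :=
  ⟨rfl, h, fun s _ => A.ucs_monotone s.le_succ,
    fun s _ _ hx y => A.ucs_monotone s.le_succ hx y, fun _ _ _ hx y => hx y⟩

theorem CentralChain.le_ucs {A : SAAStruct F L} {I : ℕ → Submodule F L} {k : ℕ}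
    (h : A.CentralChain I k) : ∀ s ≤ k, I s ≤ A.ucs s := by
  intro s
  induction s with
  | zero => exact fun _ => h.1.le
  | succ s ih => exact fun hs x hx y => ih (by omega) (h.2.2.2.2 s hs x hx y)

theorem nilClass_le {k : ℕ} (h : A.ucs k = ⊤) : A.nilClass ≤ k :=
  Nat.sInf_le ⟨_, A.centralChain_ucs h⟩

variable {A} in
theorem IsNilpotent.ucs_nilClass (h : A.IsNilpotent) : A.ucs A.nilClass = ⊤ := by
  have hmem : A.nilClass ∈ {k | ∃ I : ℕ → Submodule F L, A.CentralChain I k} := Nat.sInf_mem h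
  obtain ⟨I, hI⟩ := hmem
  exact top_le_iff.1 (hI.2.1.ge.trans (hI.le_ucs _ le_rfl))

theorem lcs_eq_of_succ_eq {i : ℕ} (h : A.lcs (i + 1) = A.lcs i) (j : ℕ) :
    A.lcs (i + j) = A.lcs i := by
  induction j with
  | zero => rfl
  | succ j ih =>
    refine le_antisymm (A.lcs_antitone (by omega)) ?_
    nth_rw 1 [← h]
    exact A.lcs_succ_le fun u hu v => A.mul_mem_lcs_succ (ih ▸ hu) v

/-- A central quotient of codimension at most one forces commutativity of the quotient. -/
theorem ucs_succ_eq_top_of_le_span_singleton_sup {m : ℕ} {c : L}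
    (h : ⊤ ≤ F ∙ c ⊔ A.ucs (m + 1)) : A.ucs (m + 1) = ⊤ := by
  refine eq_top_iff.2 fun x _ => (A.mem_ucs_succ).2 fun y => ?_
  obtain ⟨_, ha, w, hw, rfl⟩ := Submodule.mem_sup.1 (h (Submodule.mem_top (x := x)))
  obtain ⟨_, hb, w', hw', rfl⟩ := Submodule.mem_sup.1 (h (Submodule.mem_top (x := y)))
  obtain ⟨a, rfl⟩ := Submodule.mem_span_singleton.1 ha
  obtain ⟨b, rfl⟩ := Submodule.mem_span_singleton.1 hb
  have he : A.mul (a • c + w) (b • c + w') =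
      -(a • A.mul w' c) + (b • A.mul w c + A.mul w w') := by
    simp only [map_add, map_smul, LinearMap.add_apply, LinearMap.smul_apply, A.mul_alt,
      A.mul_swap c w']
    module
  rw [he]
  exact add_mem (neg_mem (Submodule.smul_mem _ _ (hw' c)))
    (add_mem (Submodule.smul_mem _ _ (hw c)) (hw w'))

theorem lcs_one_le {x y : L} (h : ⊤ ≤ Submodule.span F {x, y} ⊔ A.lcs 1) :
    A.lcs 1 ≤ F ∙ A.mul x y ⊔ A.lcs 2 := by
  refine A.lcs_succ_le fun u _ v => ?_
  obtain ⟨_, hp, w, hw, rfl⟩ := Submodule.mem_sup.1 (h (Submodule.mem_top (x := u)))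
  obtain ⟨_, hq, w', hw', rfl⟩ := Submodule.mem_sup.1 (h (Submodule.mem_top (x := v)))
  obtain ⟨a, b, rfl⟩ := Submodule.mem_span_pair.1 hp
  obtain ⟨c, d, rfl⟩ := Submodule.mem_span_pair.1 hq
  refine Submodule.mem_sup.2 ⟨(a * d - b * c) • A.mul x y,
    Submodule.smul_mem _ _ (Submodule.mem_span_singleton_self _),
    -A.mul w' (a • x + b • y) + A.mul w (c • x + d • y + w'),
    add_mem (neg_mem (A.mul_mem_lcs_succ hw' _)) (A.mul_mem_lcs_succ hw _), ?_⟩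
  simp only [map_add, map_smul, LinearMap.add_apply, LinearMap.smul_apply, A.mul_alt,
    A.mul_swap y x, A.mul_swap w' x, A.mul_swap w' y]
  module

theorem lcs_two_le {x y : L} (h : ⊤ ≤ Submodule.span F {x, y} ⊔ A.lcs 1) :
    A.lcs 2 ≤ Submodule.span F {A.mul (A.mul x y) x, A.mul (A.mul x y) y} ⊔ A.lcs 3 := by
  refine A.lcs_succ_le fun u hu v => ?_
  have h₁ := A.lcs_one_le h
  obtain ⟨_, hp, w, hw, rfl⟩ := Submodule.mem_sup.1 (h₁ hu)
  obtain ⟨_, hq, w', hw', rfl⟩ := Submodule.mem_sup.1 (h (Submodule.mem_top (x := v)))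
  obtain ⟨_, hr, t, ht, rfl⟩ := Submodule.mem_sup.1 (h₁ hw')
  obtain ⟨a, rfl⟩ := Submodule.mem_span_singleton.1 hp
  obtain ⟨e, rfl⟩ := Submodule.mem_span_singleton.1 hr
  obtain ⟨c, d, rfl⟩ := Submodule.mem_span_pair.1 hq
  refine Submodule.mem_sup.2 ⟨(a * c) • A.mul (A.mul x y) x + (a * d) • A.mul (A.mul x y) y,
    Submodule.mem_span_pair.2 ⟨_, _, rfl⟩,
    -(a • A.mul t (A.mul x y)) + A.mul w (c • x + d • y + (e • A.mul x y + t)),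
    add_mem (neg_mem (Submodule.smul_mem _ _ (A.mul_mem_lcs_succ ht _)))
      (A.mul_mem_lcs_succ hw _), ?_⟩
  simp only [map_add, map_smul, LinearMap.add_apply, LinearMap.smul_apply, A.mul_alt,
    A.mul_swap t (A.mul x y)]
  module

/-- If `L^(i+1)` has codimension at most one over `L^(i+2)` and `L^(i+1) ≤ Z_(i+2)`, then
`L^(i+2)` is orthogonal to `L^(i+1)`. -/
theorem lcs_le_ucs_succ_of_le_span_singleton_sup {i : ℕ} {c : L} (hc : c ∈ A.lcs i)
    (h : A.lcs i ≤ F ∙ c ⊔ A.lcs (i + 1)) (h' : A.lcs i ≤ A.ucs (i + 2)) :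
    A.lcs i ≤ A.ucs (i + 1) := by
  have hz {w v z : L} (hw : w ∈ A.lcs (i + 1)) (hz : z ∈ A.lcs i) : A.form (A.mul w v) z = 0 := by
    rw [A.form_swap, A.form_eq_zero_of_mem (h' hz) (A.mul_mem_lcs_succ hw v), neg_zero]
  intro z hz'
  rw [← perp_lcs, mem_perp]
  suffices hle : A.lcs (i + 1) ≤ LinearMap.ker (A.form z) from fun u hu => hle hu
  refine A.lcs_succ_le fun u hu v => ?_
  rw [LinearMap.mem_ker, A.form_swap, neg_eq_zero]
  obtain ⟨_, hp, w, hw, rfl⟩ := Submodule.mem_sup.1 (h hu)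
  obtain ⟨_, hq, w', hw', rfl⟩ := Submodule.mem_sup.1 (h hz')
  obtain ⟨a, rfl⟩ := Submodule.mem_span_singleton.1 hp
  obtain ⟨b, rfl⟩ := Submodule.mem_span_singleton.1 hq
  have h₁ : A.form (A.mul c v) c = 0 := by
    rw [A.cyclic, A.cyclic, A.mul_alt, map_zero, LinearMap.zero_apply]
  have h₂ : A.form (A.mul c v) w' = 0 := by
    rw [A.cyclic, A.mul_swap, map_neg, LinearMap.neg_apply, hz hw' hc, neg_zero]
  rw [map_add A.mul, LinearMap.add_apply, map_add A.form, LinearMap.add_apply, hz hw hz', add_zero]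
  simp only [map_add, map_smul, LinearMap.smul_apply, h₁, h₂, smul_zero, add_zero]

end SAAStruct

/-- for a nilpotent SAA of dimension `2n ≥ 12` with `dim Z(L) = 2`
and nilpotency class `k`: `L^k = Z(L)` and `5 ≤ k ≤ 2n − 3`.
(Here `A.lcs (k-1) = L^k`.) -/
theorem stmt16 (F : Type*) [Field F] (L : Type*) [AddCommGroup L] [Module F L]
    [FiniteDimensional F L] (A : SAAStruct F L) (n k : ℕ)
    (hn : 6 ≤ n) (hdim : Module.finrank F L = 2 * n)
    (hnil : A.IsNilpotent) (hZ : Module.finrank F A.center = 2)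
    (hk : A.nilClass = k) :
    A.lcs (k - 1) = A.center ∧ 5 ≤ k ∧ k ≤ 2 * n - 3 := by
  have hu1 : Module.finrank F (A.ucs 1) = 2 := by rw [A.ucs_one]; exact hZ
  have hdual := fun i => A.finrank_ucs_add_finrank_lcs i
  rw [hdim] at hdual
  have htop : A.ucs k = ⊤ := hk ▸ hnil.ucs_nilClass
  have hbot : A.lcs k = ⊥ := A.lcs_eq_bot_iff.2 htop
  have hmin : ∀ j, A.lcs j = ⊥ → k ≤ j := fun j hj =>
    hk ▸ A.nilClass_le (A.lcs_eq_bot_iff.1 hj)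
  have hl1 := hdual 1
  have hlcs_le : ∀ j, k ≤ j → A.lcs j = ⊥ := fun j hj =>
    le_bot_iff.1 ((A.lcs_antitone hj).trans hbot.le)
  have hk5 : 5 ≤ k := by
    by_contra hlt
    have h4 : A.lcs (3 + 1) = ⊥ := hlcs_le 4 (by omega)
    have h3 := Submodule.finrank_mono (A.lcs_le_ucs h4)
    obtain ⟨x, y, hxy⟩ := SAAStruct.exists_le_span_pair_sup (U := A.lcs 1)
      (by rw [finrank_top]; omega) le_top
    have e1 := (Submodule.finrank_mono (A.lcs_one_le hxy)).trans
      (SAAStruct.finrank_span_singleton_sup_le _ _)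
    have e2 := (Submodule.finrank_mono (A.lcs_two_le hxy)).trans
      (SAAStruct.finrank_span_pair_sup_le _ _ _)
    omega
  have hlast_le : A.lcs (k - 1) ≤ A.ucs 1 := A.lcs_le_ucs (hlcs_le _ (by omega))
  have hlast : 2 ≤ Module.finrank F (A.lcs (k - 1)) := by
    by_contra hlt
    have hd := hdual (k - 1)
    obtain ⟨c, -, hc⟩ := SAAStruct.exists_le_span_singleton_sup (U := A.ucs (k - 1))
      (by rw [finrank_top]; omega) le_top
    obtain ⟨m, hm⟩ : ∃ m, k - 1 = m + 1 := ⟨k - 2, by omega⟩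
    rw [hm] at hc
    have := hmin (m + 1) (A.lcs_eq_bot_iff.2 (A.ucs_succ_eq_top_of_le_span_singleton_sup hc))
    omega
  have hstrict : ∀ i < k, Module.finrank F (A.lcs (i + 1)) < Module.finrank F (A.lcs i) := by
    intro i hi
    refine Submodule.finrank_lt_finrank_of_lt
      (lt_of_le_of_ne (A.lcs_antitone i.le_succ) fun he => ?_)
    have := A.lcs_eq_of_succ_eq he (k - i)
    rw [Nat.add_sub_cancel' hi.le, hbot] at this
    exact absurd (hmin i this.symm) (by omega)
  have hdrop : ∀ i j, i + j ≤ k →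
      Module.finrank F (A.lcs (i + j)) + j ≤ Module.finrank F (A.lcs i) := by
    intro i j
    induction j with
    | zero => simp
    | succ j ih =>
      intro hj
      have h₁ := ih (by omega)
      have h₂ := hstrict (i + j) (by omega)
      rw [← Nat.add_assoc i j 1]
      omega
  have hkle := hdrop 1 (k - 2) (by omega)
  rw [show 1 + (k - 2) = k - 1 by omega] at hkle
  refine ⟨?_, hk5, ?_⟩
  · rw [← A.ucs_one]
    exact Submodule.eq_of_le_of_finrank_le hlast_le (by omega)
  · by_contra hlt
    obtain ⟨m, rfl⟩ : ∃ m, n = m + 2 := ⟨n - 2, by omega⟩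
    have upper : ∀ i, i ≤ k - 2 → Module.finrank F (A.lcs (1 + i)) = 2 * m + 2 - i := by
      intro i hi
      have h₁ := hdrop 1 i (by omega)
      have h₂ := hdrop (1 + i) (k - 2 - i) (by omega)
      rw [show 1 + i + (k - 2 - i) = k - 1 by omega] at h₂
      omega
    have hm0 := upper (m - 1) (by omega)
    have hm1 := upper m (by omega)
    rw [show 1 + (m - 1) = m by omega] at hm0
    rw [Nat.add_comm 1 m] at hm1
    obtain ⟨c, hcm, hc⟩ := SAAStruct.exists_le_span_singleton_sup (U := A.lcs (m + 1))
      (V := A.lcs m) (by omega) (A.lcs_antitone m.le_succ)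
    have hle := A.lcs_le_ucs_succ_of_le_span_singleton_sup hcm hc
      (A.lcs_le_ucs (hlcs_le _ (by omega)))
    have := Submodule.finrank_mono hle
    have := hdual (m + 1)
    omega
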